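/- arXiv:1607.03255 — 3 statements merged into one kernel-verified Lean document; each statement's English description precedes it below -/
import Mathlib

section
/- Let E and F be real normed vector spaces, K : E → F a continuous linear map, u₀, g ∈ E, c ∈ ℝ, f ∈ F, and c_K ≥ 0. Set u = u₀ + c • g and a = ‖K‖ ‖u₀‖ + ‖f‖, where ‖K‖ is the operator norm. If ‖K u − f‖ ≤ c_K and K g ≠ 0, then |c| ≤ (a + √(a² + c_K²)) / ‖K g‖. -/
/-- Abstract coercivity step: for a bounded linear operator `K` with `K g ≠ 0`,
a bound `‖K(u₀ + c • g) − f‖ ≤ c_K` controls the coefficient `c`. -/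
theorem mean_value_bound {E F : Type*} [NormedAddCommGroup E] [NormedSpace ℝ E]
    [NormedAddCommGroup F] [NormedSpace ℝ F]
    (K : E →L[ℝ] F) (u₀ g : E) (c : ℝ) (f : F) (cK : ℝ) (hcK : 0 ≤ cK)
    (h : ‖K (u₀ + c • g) - f‖ ≤ cK) (hg : K g ≠ 0) :
    |c| ≤ ((‖K‖ * ‖u₀‖ + ‖f‖) +
      Real.sqrt ((‖K‖ * ‖u₀‖ + ‖f‖) ^ 2 + cK ^ 2)) / ‖K g‖ := by
  rw [le_div_iff₀ (norm_pos_iff.mpr hg)]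
  have hsqrt : cK ≤ Real.sqrt ((‖K‖ * ‖u₀‖ + ‖f‖) ^ 2 + cK ^ 2) :=
    Real.le_sqrt_of_sq_le (le_add_of_nonneg_left (sq_nonneg _))
  calc |c| * ‖K g‖ = ‖(K (u₀ + c • g) - f) - (K u₀ - f)‖ := by
        rw [← Real.norm_eq_abs, ← norm_smul, map_add, map_smul]
        congr 1
        abel
    _ ≤ ‖K (u₀ + c • g) - f‖ + ‖K u₀ - f‖ := norm_sub_le _ _
    _ ≤ cK + (‖K‖ * ‖u₀‖ + ‖f‖) :=
        add_le_add h ((norm_sub_le _ _).trans (by gcongr; exact K.le_opNorm u₀))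
    _ ≤ _ := by linarith
end

section
/- (Aubin–Lions) Let X, Y, Z be real Banach spaces, let j : X → Y be a compact continuous linear map, and let i : Y → Z be an injective continuous linear map. Let 1 ≤ p < ∞ and 1 < q, let T > 0, let C > 0, and let (uₙ) be a sequence of strongly measurable functions uₙ : [0,T] → X with ∫₀ᵀ ‖uₙ(t)‖ₓᵖ dt ≤ C, and suppose there exist Bochner integrable functions vₙ : [0,T] → Z with ∫₀ᵀ ‖vₙ(t)‖_Z^q dt ≤ C such that for almost every t ∈ [0,T], i(j(uₙ(t))) = i(j(uₙ(0))) + ∫₀ᵗ vₙ(s) ds (i.e. vₙ is the time derivative of i∘j∘uₙ in the integral sense). Then the sequence (j ∘ uₙ) has a subsequence that converges in the Bochner space L^p(0,T;Y), i.e. there is a subsequence (nₖ) and a function w ∈ L^p(0,T;Y) with ∫₀ᵀ ‖j(u_{nₖ}(t)) − w(t)‖_Y^p dt → 0. -/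
open MeasureTheory

open Filter Topology Set

/-- **Ehrling's lemma**. -/
theorem IsCompactOperator.exists_norm_le_add {X Y Z : Type*}
    [NormedAddCommGroup X] [NormedSpace ℝ X] [NormedAddCommGroup Y] [NormedSpace ℝ Y]
    [NormedAddCommGroup Z] [NormedSpace ℝ Z] {j : X →L[ℝ] Y} (hj : IsCompactOperator j)
    {i : Y →L[ℝ] Z} (hi : Function.Injective i) {ε : ℝ} (hε : 0 < ε) :
    ∃ M : ℝ, 0 ≤ M ∧ ∀ x, ‖j x‖ ≤ ε * ‖x‖ + M * ‖i (j x)‖ := by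
  by_contra! H
  have key : ∀ n : ℕ, ∃ y : X, ‖y‖ ≤ 1 ∧ ε + n * ‖i (j y)‖ < ‖j y‖ := by
    intro n
    obtain ⟨x, hx⟩ := H n n.cast_nonneg
    have hx0 : 0 < ‖x‖ := by
      refine norm_pos_iff.2 fun h ↦ ?_
      simp [h] at hx
    refine ⟨‖x‖⁻¹ • x, by simp [norm_smul, hx0.ne'], ?_⟩
    simp only [map_smul, norm_smul, norm_inv, norm_norm]
    have := mul_lt_mul_of_pos_left hx (inv_pos.2 hx0)
    calc _ = ‖x‖⁻¹ * (ε * ‖x‖ + n * ‖i (j x)‖) := by field_simp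
      _ < _ := this
  choose y hy1 hy using key
  have hK := IsCompactOperator.isCompact_closure_image_closedBall (f := (j : X →ₗ[ℝ] Y)) hj 1
  obtain ⟨a, -, φ, hφ, ha⟩ := hK.tendsto_subseq (x := fun n ↦ j (y n))
    fun n ↦ subset_closure ⟨y n, by simpa using hy1 n, rfl⟩
  have hia : Tendsto (fun n ↦ ‖i (j (y (φ n)))‖) atTop (𝓝 0) := by
    refine squeeze_zero' (g := fun n : ℕ ↦ ‖j‖ / (φ n : ℝ)) (.of_forall fun _ ↦ norm_nonneg _) ?_ ?_
    · filter_upwards [hφ.tendsto_atTop.eventually_gt_atTop 0] with n hn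
      rw [le_div_iff₀ (by exact_mod_cast hn)]
      have h1 := hy (φ n)
      have h2 : ‖j (y (φ n))‖ ≤ ‖j‖ := (j.le_opNorm _).trans
        (mul_le_of_le_one_right (norm_nonneg _) (hy1 _))
      linarith
    · exact (tendsto_const_nhds.div_atTop tendsto_natCast_atTop_atTop).comp hφ.tendsto_atTop
  have hia' : Tendsto (fun n ↦ ‖i (j (y (φ n)))‖) atTop (𝓝 ‖i a‖) :=
    ((i.continuous.tendsto a).comp ha).norm
  have ha0 : a = 0 := hi (by simpa using tendsto_nhds_unique hia' hia)
  have : ε ≤ ‖a‖ := ge_of_tendsto' ha.norm fun n ↦ by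
    have := hy (φ n)
    have : 0 ≤ (φ n : ℝ) * ‖i (j (y (φ n)))‖ := by positivity
    simp only [Function.comp_apply]
    linarith
  simp [ha0] at this
  linarith

theorem lintegral_ofReal_norm_rpow {α E : Type*} [MeasurableSpace α] [NormedAddCommGroup E]
    {μ : Measure α} {p : ℝ} (hp : 0 < p) (f : α → E) :
    ∫⁻ t, ENNReal.ofReal (‖f t‖ ^ p) ∂μ = eLpNorm f (ENNReal.ofReal p) μ ^ p := by
  rw [eLpNorm_eq_lintegral_rpow_enorm_toReal (by simpa using hp) (by simp),
    ENNReal.toReal_ofReal hp.le, ← ENNReal.rpow_mul, one_div, inv_mul_cancel₀ hp.ne',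
    ENNReal.rpow_one]
  simp_rw [← ENNReal.ofReal_rpow_of_nonneg (norm_nonneg _) hp.le, ofReal_norm]

theorem eLpNorm_le_ofReal_of_lintegral_le {α E : Type*} [MeasurableSpace α]
    [NormedAddCommGroup E] {μ : Measure α} {p C : ℝ} (hp : 0 < p) (hC : 0 ≤ C) {f : α → E}
    (h : ∫⁻ t, ENNReal.ofReal (‖f t‖ ^ p) ∂μ ≤ ENNReal.ofReal C) :
    eLpNorm f (ENNReal.ofReal p) μ ≤ ENNReal.ofReal (C ^ (1 / p)) := by
  rw [lintegral_ofReal_norm_rpow hp] at h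
  rwa [← ENNReal.ofReal_rpow_of_nonneg hC (by positivity), one_div,
    ENNReal.le_rpow_inv_iff hp]

theorem norm_setIntegral_sub_setIntegral_le {E : Type*} [NormedAddCommGroup E] [NormedSpace ℝ E]
    {q T C a b s t : ℝ} {v : ℝ → E} (hq : 1 < q) (hC : 0 ≤ C)
    (hv : IntegrableOn v (Ioc 0 T))
    (hvC : ∫⁻ t in Ioc (0 : ℝ) T, ENNReal.ofReal (‖v t‖ ^ q) ≤ ENNReal.ofReal C)
    (ha : 0 ≤ a) (hb : b ≤ T) (hs : s ∈ Ioc a b) (ht : t ∈ Ioc a b) :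
    ‖(∫ x in Ioc 0 t, v x) - ∫ x in Ioc 0 s, v x‖ ≤ C ^ (1 / q) * (b - a) ^ (1 - 1 / q) := by
  wlog hst : s ≤ t generalizing s t
  · rw [norm_sub_rev]
    exact this ht hs (le_of_not_ge hst)
  have hab : a ≤ b := hs.1.le.trans hs.2
  have hs0 : 0 ≤ s := ha.trans hs.1.le
  have hsub : Ioc a b ⊆ Ioc 0 T := Ioc_subset_Ioc ha hb
  have hst' : Ioc s t ⊆ Ioc a b := Ioc_subset_Ioc hs.1.le ht.2
  have heq : (∫ x in Ioc 0 t, v x) - ∫ x in Ioc 0 s, v x = ∫ x in Ioc s t, v x := by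
    rw [← Ioc_union_Ioc_eq_Ioc hs0 hst, setIntegral_union (Ioc_disjoint_Ioc_of_le le_rfl)
      measurableSet_Ioc (hv.mono_set (Ioc_subset_Ioc_right (hs.2.trans hb)))
      (hv.mono_set (hst'.trans hsub)), add_sub_cancel_left]
  have hq0 : 0 < q := by linarith
  rw [heq, ← ENNReal.ofReal_le_ofReal_iff (by have := sub_nonneg.2 hab; positivity), ofReal_norm]
  calc ‖∫ x in Ioc s t, v x‖ₑ ≤ ∫⁻ x in Ioc s t, ‖v x‖ₑ := enorm_integral_le_lintegral_enorm _
    _ ≤ ∫⁻ x in Ioc a b, ‖v x‖ₑ := lintegral_mono_set hst'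
    _ = eLpNorm v 1 (volume.restrict (Ioc a b)) := eLpNorm_one_eq_lintegral_enorm.symm
    _ ≤ eLpNorm v (ENNReal.ofReal q) (volume.restrict (Ioc a b)) *
        ENNReal.ofReal (b - a) ^ (1 - 1 / q) := by
      have := eLpNorm_le_eLpNorm_mul_rpow_measure_univ (p := 1) (q := ENNReal.ofReal q)
        (by simpa using hq.le) (hv.mono_set hsub).aestronglyMeasurable
      simpa [ENNReal.toReal_ofReal hq0.le] using this
    _ ≤ ENNReal.ofReal (C ^ (1 / q)) * ENNReal.ofReal (b - a) ^ (1 - 1 / q) := by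
      gcongr
      exact (eLpNorm_mono_measure _ (Measure.restrict_mono_set _ hsub)).trans
        (eLpNorm_le_ofReal_of_lintegral_le hq0 hC hvC)
    _ = _ := by
      have : 0 ≤ 1 - 1 / q := by
        rw [sub_nonneg, div_le_one hq0]; exact hq.le
      rw [ENNReal.ofReal_rpow_of_nonneg (sub_nonneg.2 hab) this,
        ← ENNReal.ofReal_mul (by positivity)]

theorem exists_mem_Ioc_norm_le {E : Type*} [NormedAddCommGroup E]
    {p T C a b : ℝ} {f : ℝ → E} (hp : 0 < p) (hC : 0 ≤ C)
    (hf : AEStronglyMeasurable f (volume.restrict (Ioc 0 T)))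
    (hfC : ∫⁻ t in Ioc (0 : ℝ) T, ENNReal.ofReal (‖f t‖ ^ p) ≤ ENNReal.ofReal C)
    (ha : 0 ≤ a) (hab : a < b) (hb : b ≤ T) {P : ℝ → Prop}
    (hP : ∀ᵐ t ∂(volume.restrict (Ioc (0 : ℝ) T)), P t) :
    ∃ t ∈ Ioc a b, P t ∧ ‖f t‖ ≤ (C / (b - a)) ^ (1 / p) := by
  have hle : volume.restrict (Ioc a b) ≤ volume.restrict (Ioc 0 T) :=
    Measure.restrict_mono_set _ (Ioc_subset_Ioc ha hb)
  have hPab : ∀ᵐ t ∂(volume.restrict (Ioc a b)), t ∈ Ioc a b ∧ P t :=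
    (ae_restrict_mem measurableSet_Ioc).and (Measure.absolutelyContinuous_of_le hle hP)
  obtain ⟨t, ht, hft⟩ := exists_notMem_null_le_laverage
    (μ := volume.restrict (Ioc a b)) (f := fun t ↦ ENNReal.ofReal (‖f t‖ ^ p))
    (by simpa [Measure.restrict_eq_zero] using hab)
    (((hf.mono_measure hle).norm.aemeasurable.pow_const p).ennreal_ofReal) (ae_iff.1 hPab)
  obtain ⟨ht, hPt⟩ := of_not_not ht
  refine ⟨t, ht, hPt, ?_⟩
  have hba : 0 < b - a := sub_pos.2 hab
  rw [setLAverage_eq, Real.volume_Ioc] at hft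
  have : ENNReal.ofReal (‖f t‖ ^ p) ≤ ENNReal.ofReal (C / (b - a)) := by
    rw [ENNReal.ofReal_div_of_pos hba]
    refine hft.trans (ENNReal.div_le_div_right ?_ _)
    exact (lintegral_mono' hle le_rfl).trans hfC
  rw [ENNReal.ofReal_le_ofReal_iff (by positivity)] at this
  rwa [one_div, Real.le_rpow_inv_iff_of_pos (norm_nonneg _) (by positivity) hp]

theorem totallyBounded_range_of_forall_dist_lt {ι α β : Type*} [PseudoEMetricSpace α] {g : ι → α}
    [PseudoMetricSpace β]
    (H : ∀ ε : ℝ, 0 < ε → ∃ (N : ℕ) (Φ : ι → Fin N → β) (δ : ℝ), 0 < δ ∧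
      TotallyBounded (range Φ) ∧
      ∀ m n, dist (Φ m) (Φ n) < δ → edist (g m) (g n) ≤ ENNReal.ofReal ε) :
    TotallyBounded (range g) := by
  refine EMetric.totallyBounded_iff.2 fun ε hε ↦ ?_
  obtain ⟨r, hr, hrε⟩ : ∃ r : ℝ, 0 < r ∧ ENNReal.ofReal r < ε := by
    obtain ⟨r, hr, hrε⟩ := ENNReal.lt_iff_exists_nnreal_btwn.1 hε
    exact ⟨r, by simpa using hr, by simpa using hrε⟩
  obtain ⟨N, Φ, δ, hδ, htb, h⟩ := H r hr
  have hcov := Metric.finite_approx_of_totallyBounded htb δ hδ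
  rw [← image_univ, exists_subset_image_finite_and] at hcov
  obtain ⟨s, -, hs, hcov⟩ := hcov
  refine ⟨g '' s, hs.image g, ?_⟩
  rintro _ ⟨m, rfl⟩
  obtain ⟨n, hn, hmn⟩ : ∃ n ∈ s, dist (Φ m) (Φ n) < δ := by
    simpa using hcov (mem_image_of_mem Φ (mem_univ m))
  exact mem_iUnion₂.2 ⟨g n, mem_image_of_mem g hn, (h m n hmn).trans_lt hrε⟩

theorem exists_nat_mul_rpow_le {B T r η : ℝ} (hr : 0 < r) (hη : 0 < η) :
    ∃ N : ℕ, 0 < N ∧ B * (T / N) ^ r ≤ η := by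
  have h1 : Tendsto (fun N : ℕ ↦ T / (N : ℝ)) atTop (𝓝 0) :=
    tendsto_const_nhds.div_atTop tendsto_natCast_atTop_atTop
  have h2 : Tendsto (fun N : ℕ ↦ B * (T / (N : ℝ)) ^ r) atTop (𝓝 0) := by
    simpa [Real.zero_rpow hr.ne'] using (h1.rpow_const (Or.inr hr.le)).const_mul B
  obtain ⟨N, hN, hN0⟩ := ((h2.eventually_le_const hη).and (eventually_gt_atTop 0)).exists
  exact ⟨N, hN0, hN⟩

theorem exists_fin_mem_Ioc {T t : ℝ} {N : ℕ} (hN : 0 < N) (ht : t ∈ Ioc 0 T) :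
    ∃ k : Fin N, t ∈ Ioc (k * (T / N)) ((k + 1) * (T / N)) := by
  have hN' : (0 : ℝ) < N := by exact_mod_cast hN
  have hT : 0 < T := ht.1.trans_le ht.2
  have hh : 0 < T / N := by positivity
  have hpos : 0 < ⌈t / (T / N)⌉₊ := Nat.ceil_pos.2 (div_pos ht.1 hh)
  have hle : ⌈t / (T / N)⌉₊ ≤ N := by
    rw [Nat.ceil_le, div_le_iff₀ hh, mul_div_cancel₀ _ hN'.ne']
    exact ht.2
  obtain ⟨k, hk⟩ := Nat.exists_eq_succ_of_ne_zero hpos.ne'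
  have hkN : k < N := by omega
  refine ⟨⟨k, hkN⟩, ?_, ?_⟩
  · rw [← lt_div_iff₀ hh]
    exact Nat.lt_ceil.1 (hk ▸ k.lt_succ_self)
  · rw [← div_le_iff₀ hh]
    have := Nat.le_ceil (t / (T / N))
    rw [hk] at this
    exact_mod_cast this

theorem eLpNorm_sub_le_of_norm_sub_le {E F : Type*} [NormedAddCommGroup E] [NormedAddCommGroup F]
    {p T A ε K : ℝ} {f₁ f₂ : ℝ → E} {g : ℝ → F} (hp : 1 ≤ p) (hT : 0 < T) (hA : 0 ≤ A) (hε : 0 ≤ ε)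
    (hK : 0 ≤ K)
    (hf₁ : AEStronglyMeasurable f₁ (volume.restrict (Ioc 0 T)))
    (hf₂ : AEStronglyMeasurable f₂ (volume.restrict (Ioc 0 T)))
    (h₁ : eLpNorm f₁ (ENNReal.ofReal p) (volume.restrict (Ioc 0 T)) ≤ ENNReal.ofReal A)
    (h₂ : eLpNorm f₂ (ENNReal.ofReal p) (volume.restrict (Ioc 0 T)) ≤ ENNReal.ofReal A)
    (hg : ∀ᵐ t ∂(volume.restrict (Ioc 0 T)), ‖g t‖ ≤ ε * ‖f₁ t - f₂ t‖ + K) :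
    eLpNorm g (ENNReal.ofReal p) (volume.restrict (Ioc 0 T)) ≤
      ENNReal.ofReal (ε * (2 * A) + K * T ^ (1 / p)) := by
  have hp0 : 0 < p := by linarith
  have hp1 : 1 ≤ ENNReal.ofReal p := by simpa using hp
  have hsub : AEStronglyMeasurable (fun t ↦ ‖f₁ t - f₂ t‖) (volume.restrict (Ioc 0 T)) :=
    (hf₁.sub hf₂).norm
  calc eLpNorm g (ENNReal.ofReal p) (volume.restrict (Ioc 0 T))
      ≤ eLpNorm ((ε • fun t ↦ ‖f₁ t - f₂ t‖) + fun _ ↦ K) (ENNReal.ofReal p)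
          (volume.restrict (Ioc 0 T)) := eLpNorm_mono_ae_real hg
    _ ≤ eLpNorm (ε • fun t ↦ ‖f₁ t - f₂ t‖) (ENNReal.ofReal p) (volume.restrict (Ioc 0 T)) +
        eLpNorm (fun _ ↦ K) (ENNReal.ofReal p) (volume.restrict (Ioc 0 T)) :=
      eLpNorm_add_le (hsub.const_smul ε) aestronglyMeasurable_const hp1
    _ ≤ ENNReal.ofReal ε * (ENNReal.ofReal A + ENNReal.ofReal A) +
        ENNReal.ofReal K * ENNReal.ofReal T ^ (1 / p) := by
      gcongr ?_ + ?_
      · rw [eLpNorm_const_smul, Real.enorm_of_nonneg hε]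
        gcongr
        refine (eLpNorm_norm _).trans_le ((eLpNorm_sub_le hf₁ hf₂ hp1).trans ?_)
        gcongr
      · rw [eLpNorm_const _ (by simpa using hp0) (by simpa [Measure.restrict_eq_zero] using hT),
          Real.enorm_of_nonneg hK]
        simp [ENNReal.toReal_ofReal hp0.le]
    _ = _ := by
      rw [ENNReal.ofReal_rpow_of_nonneg hT.le (by positivity), ← ENNReal.ofReal_add hA hA,
        ← ENNReal.ofReal_mul hε, ← ENNReal.ofReal_mul hK,
        ← ENNReal.ofReal_add (by positivity) (by positivity), two_mul]

/-- Aubin–Lions lemma: if `uₙ` is bounded in `L^p(0,T;X)`, `j : X → Y` is a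
compact operator, `i : Y → Z` is an injective continuous linear map, and the
time derivatives `vₙ` of `i ∘ j ∘ uₙ` (in the integral sense) are bounded in
`L^q(0,T;Z)` with `q > 1`, then `(j ∘ uₙ)` has a subsequence converging in
`L^p(0,T;Y)`. -/
theorem aubin_lions {X Y Z : Type*}
    [NormedAddCommGroup X] [NormedSpace ℝ X] [CompleteSpace X]
    [NormedAddCommGroup Y] [NormedSpace ℝ Y] [CompleteSpace Y]
    [NormedAddCommGroup Z] [NormedSpace ℝ Z] [CompleteSpace Z]
    (j : X →L[ℝ] Y) (hj : IsCompactOperator j)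
    (i : Y →L[ℝ] Z) (hi : Function.Injective i)
    (p q T C : ℝ) (hp : 1 ≤ p) (hq : 1 < q) (hT : 0 < T) (hC : 0 < C)
    (u : ℕ → ℝ → X)
    (humeas : ∀ n, AEStronglyMeasurable (u n) (volume.restrict (Set.Ioc 0 T)))
    (hubdd : ∀ n, ∫⁻ t in Set.Ioc (0:ℝ) T, ENNReal.ofReal (‖u n t‖ ^ p)
      ≤ ENNReal.ofReal C)
    (v : ℕ → ℝ → Z)
    (hvint : ∀ n, IntegrableOn (v n) (Set.Ioc 0 T))
    (hvbdd : ∀ n, ∫⁻ t in Set.Ioc (0:ℝ) T, ENNReal.ofReal (‖v n t‖ ^ q)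
      ≤ ENNReal.ofReal C)
    (hderiv : ∀ n, ∀ᵐ t ∂(volume.restrict (Set.Ioc (0:ℝ) T)),
      i (j (u n t)) = i (j (u n 0)) + ∫ s in Set.Ioc (0:ℝ) t, v n s) :
    ∃ φ : ℕ → ℕ, StrictMono φ ∧ ∃ w : ℝ → Y,
      AEStronglyMeasurable w (volume.restrict (Set.Ioc 0 T)) ∧
      (∫⁻ t in Set.Ioc (0:ℝ) T, ENNReal.ofReal (‖w t‖ ^ p)) < ⊤ ∧
      Filter.Tendsto
        (fun k => ∫⁻ t in Set.Ioc (0:ℝ) T,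
          ENNReal.ofReal (‖j (u (φ k) t) - w t‖ ^ p))
        Filter.atTop (nhds 0) := by
  have hp0 : 0 < p := by linarith
  have hq0 : 0 < q := by linarith
  have : Fact (1 ≤ ENNReal.ofReal p) := ⟨by simpa using hp⟩
  have hbd n := eLpNorm_le_ofReal_of_lintegral_le hp0 hC.le (hubdd n)
  have hju n : MemLp (fun t ↦ j (u n t)) (ENNReal.ofReal p) (volume.restrict (Ioc 0 T)) :=
    j.comp_memLp' ⟨humeas n, (hbd n).trans_lt ENNReal.ofReal_lt_top⟩
  have htb : TotallyBounded (range fun n ↦ (hju n).toLp) := by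
    refine totallyBounded_range_of_forall_dist_lt (β := Y) fun ε hε ↦ ?_
    set A := C ^ (1 / p)
    have hA : 0 ≤ A := by positivity
    obtain ⟨M, hM, hEhr⟩ := hj.exists_norm_le_add hi (ε := ε / (4 * (A + 1))) (by positivity)
    have hTp : 0 < T ^ (1 / p) := by positivity
    set η := ε / (2 * (M * T ^ (1 / p) + 1)) with hηdef
    have hη : 0 < η := by positivity
    obtain ⟨N, hN, hNη⟩ := exists_nat_mul_rpow_le (B := C ^ (1 / q)) (T := T) (r := 1 - 1 / q)
      (η := η / 4) (by rw [sub_pos, div_lt_one hq0]; exact hq) (by positivity)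
    have hN' : (0 : ℝ) < N := by exact_mod_cast hN
    have hh : 0 < T / N := by positivity
    have hkT (k : Fin N) : (k + 1) * (T / N) ≤ T := by
      have : ((k : ℕ) + 1 : ℝ) ≤ N := by exact_mod_cast k.2
      calc _ ≤ N * (T / N) := by gcongr
        _ = T := mul_div_cancel₀ _ hN'.ne'
    have hlen (k : Fin N) : (k + 1) * (T / N) - k * (T / N) = T / N := by ring
    have hτ (n : ℕ) (k : Fin N) := exists_mem_Ioc_norm_le hp0 hC.le (humeas n) (hubdd n)
      (a := k * (T / N)) (b := (k + 1) * (T / N)) (by positivity)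
      (by linarith [hlen k]) (hkT k) (hderiv n)
    choose τ hτmem hτeq hτle using hτ
    have hosc (n : ℕ) {t : ℝ} {k : Fin N}
        (ht : t ∈ Ioc (k * (T / N)) ((k + 1) * (T / N)))
        (hteq : i (j (u n t)) = i (j (u n 0)) + ∫ s in Ioc (0 : ℝ) t, v n s) :
        ‖i (j (u n t)) - i (j (u n (τ n k)))‖ ≤ η / 4 := by
      rw [hteq, hτeq n k, add_sub_add_left_eq_sub]
      refine (norm_setIntegral_sub_setIntegral_le hq hC.le (hvint n) (hvbdd n) (by positivity)
        (hkT k) (hτmem n k) ht).trans ?_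
      rwa [hlen]
    refine ⟨N, fun n k ↦ j (u n (τ n k)), η / (2 * (‖i‖ + 1)), by positivity, ?_, ?_⟩
    · have hK := IsCompactOperator.isCompact_closure_image_closedBall
        (f := (j : X →ₗ[ℝ] Y)) hj ((C / (T / N)) ^ (1 / p))
      refine (isCompact_univ_pi fun _ : Fin N ↦ hK).totallyBounded.subset ?_
      rintro _ ⟨n, rfl⟩ k -
      refine subset_closure ⟨u n (τ n k), ?_, rfl⟩
      simpa [hlen] using hτle n k
    · intro m n hmn
      rw [Lp.edist_toLp_toLp]
      refine (eLpNorm_sub_le_of_norm_sub_le hp hT hA (ε := ε / (4 * (A + 1))) (K := M * η)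
        (by positivity) (by positivity) (humeas m) (humeas n) (hbd m) (hbd n) ?_).trans ?_
      · filter_upwards [hderiv m, hderiv n, ae_restrict_mem measurableSet_Ioc] with t hm hn ht
        obtain ⟨k, hk⟩ := exists_fin_mem_Ioc hN ht
        have hE := hEhr (u m t - u n t)
        simp only [map_sub, Pi.sub_apply] at hE ⊢
        refine hE.trans ?_
        gcongr
        have hk' : ‖i (j (u m (τ m k))) - i (j (u n (τ n k)))‖ ≤ η / 2 := by
          rw [← map_sub]
          calc _ ≤ ‖i‖ * ‖j (u m (τ m k)) - j (u n (τ n k))‖ := i.le_opNorm _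
            _ ≤ (‖i‖ + 1) * (η / (2 * (‖i‖ + 1))) := by
              gcongr
              · linarith
              · rw [← dist_eq_norm]
                exact ((dist_le_pi_dist _ _ k).trans_lt hmn).le
            _ = η / 2 := by field_simp
        have h1 := hosc m hk hm
        have h2 := hosc n hk hn
        rw [norm_sub_rev] at h2
        calc _ = ‖(i (j (u m t)) - i (j (u m (τ m k)))) +
              (i (j (u m (τ m k))) - i (j (u n (τ n k)))) +
              (i (j (u n (τ n k))) - i (j (u n t)))‖ := by congr 1; abel
          _ ≤ _ := norm_add₃_le
          _ ≤ η := by linarith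
      · refine ENNReal.ofReal_le_ofReal ?_
        have h1 : ε / (4 * (A + 1)) * (2 * A) ≤ ε / 2 := by
          rw [div_mul_eq_mul_div, div_le_div_iff₀ (by positivity) (by positivity)]
          nlinarith
        have h2 : M * η * T ^ (1 / p) ≤ ε / 2 := by
          rw [hηdef, mul_div_assoc', div_mul_eq_mul_div,
            div_le_div_iff₀ (by positivity) (by positivity)]
          nlinarith
        linarith
  obtain ⟨w, -, φ, hφ, hw⟩ := (htb.closure.isCompact_of_isClosed isClosed_closure).tendsto_subseq
    fun n ↦ subset_closure (mem_range_self n)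
  refine ⟨φ, hφ, w, Lp.aestronglyMeasurable w, ?_, ?_⟩
  · rw [lintegral_ofReal_norm_rpow hp0]
    exact ENNReal.rpow_lt_top_of_nonneg hp0.le (Lp.eLpNorm_ne_top w)
  · rw [← Lp.toLp_coeFn w (Lp.memLp w)] at hw
    have := (Lp.tendsto_Lp_iff_tendsto_eLpNorm'' (fun n t ↦ j (u (φ n) t))
      (fun n ↦ hju (φ n)) w (Lp.memLp w)).1 hw
    simp_rw [lintegral_ofReal_norm_rpow hp0]
    have h := this.ennrpow_const p
    rw [ENNReal.zero_rpow_of_pos hp0] at h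
    exact h
end

section
/- Let H be a real inner product space, let b ∈ H with b ≠ 0, let a ∈ ℝ, τ > 0, and ṽ ∈ H, and define ρ(v) = a + ⟨b, v⟩. Then the function v ↦ (1/2)‖v − ṽ‖² + τ|ρ(v)| has a unique minimizer v* over H, given by the affine shrinkage formula: v* = ṽ + τ b if ρ(ṽ) < −τ‖b‖²; v* = ṽ − τ b if ρ(ṽ) > τ‖b‖²; and v* = ṽ − (ρ(ṽ)/‖b‖²) b if |ρ(ṽ)| ≤ τ‖b‖². -/
open scoped RealInnerProductSpace

/-- If `s` is a subgradient of `τ|·|` at the residual of `w = u - s • b`, the objective exceeds its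
value at `w` by at least `(1/2)‖v - w‖²`. -/
theorem prox_abs_affine_add_sq_le {H : Type*} [NormedAddCommGroup H] [InnerProductSpace ℝ H]
    {b u w : H} {a τ s : ℝ} (hw : w = u - s • b) (hs : |s| ≤ τ)
    (hsub : s * (a + ⟪b, w⟫) = τ * |a + ⟪b, w⟫|) (v : H) :
    (1/2) * ‖w - u‖ ^ 2 + τ * |a + ⟪b, w⟫| + (1/2) * ‖v - w‖ ^ 2
      ≤ (1/2) * ‖v - u‖ ^ 2 + τ * |a + ⟪b, v⟫| := by
  have hwu : w - u = -(s • b) := by rw [hw]; abel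
  have hvu : v - u = (v - w) + (w - u) := by abel
  have hcross : ⟪v - w, w - u⟫ = -(s * (⟪b, v⟫ - ⟪b, w⟫)) := by
    rw [hwu, inner_neg_right, real_inner_smul_right, real_inner_comm, inner_sub_right]
  have hnorm := norm_add_sq_real (v - w) (w - u)
  rw [← hvu, hcross] at hnorm
  have habs : s * (a + ⟪b, v⟫) ≤ τ * |a + ⟪b, v⟫| :=
    (le_abs_self _).trans (by rw [abs_mul]; gcongr)
  linarith

/-- Affine shrinkage formula: the unique minimizer of
`v ↦ (1/2)‖v − ṽ‖² + τ|a + ⟨b, v⟩|` over a real inner product space,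
with `b ≠ 0` and `τ > 0`, is given by a three-case affine shrinkage. -/
theorem affine_shrinkage {H : Type*} [NormedAddCommGroup H] [InnerProductSpace ℝ H]
    (b : H) (hb : b ≠ 0) (a τ : ℝ) (hτ : 0 < τ) (vtil : H) :
    (∀ v : H,
      (1/2) * ‖(if a + ⟪b, vtil⟫ < -(τ * ‖b‖ ^ 2) then vtil + τ • b
        else if τ * ‖b‖ ^ 2 < a + ⟪b, vtil⟫ then vtil - τ • b
        else vtil - ((a + ⟪b, vtil⟫) / ‖b‖ ^ 2) • b) - vtil‖ ^ 2
        + τ * |a + ⟪b, (if a + ⟪b, vtil⟫ < -(τ * ‖b‖ ^ 2) then vtil + τ • b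
          else if τ * ‖b‖ ^ 2 < a + ⟪b, vtil⟫ then vtil - τ • b
          else vtil - ((a + ⟪b, vtil⟫) / ‖b‖ ^ 2) • b)⟫|
      ≤ (1/2) * ‖v - vtil‖ ^ 2 + τ * |a + ⟪b, v⟫|) ∧
    (∀ v : H,
      (∀ z : H, (1/2) * ‖v - vtil‖ ^ 2 + τ * |a + ⟪b, v⟫|
        ≤ (1/2) * ‖z - vtil‖ ^ 2 + τ * |a + ⟪b, z⟫|) →
      v = (if a + ⟪b, vtil⟫ < -(τ * ‖b‖ ^ 2) then vtil + τ • b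
        else if τ * ‖b‖ ^ 2 < a + ⟪b, vtil⟫ then vtil - τ • b
        else vtil - ((a + ⟪b, vtil⟫) / ‖b‖ ^ 2) • b)) := by
  have hb2 : 0 < ‖b‖ ^ 2 := by positivity
  set w : H := if a + ⟪b, vtil⟫ < -(τ * ‖b‖ ^ 2) then vtil + τ • b
    else if τ * ‖b‖ ^ 2 < a + ⟪b, vtil⟫ then vtil - τ • b
    else vtil - ((a + ⟪b, vtil⟫) / ‖b‖ ^ 2) • b with hw
  have hinner : ∀ s : ℝ, a + ⟪b, vtil - s • b⟫ = a + ⟪b, vtil⟫ - s * ‖b‖ ^ 2 := fun s => by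
    rw [inner_sub_right, real_inner_smul_right, real_inner_self_eq_norm_sq]; ring
  obtain ⟨s, hws, hs, hsub⟩ : ∃ s : ℝ, w = vtil - s • b ∧ |s| ≤ τ ∧
      s * (a + ⟪b, w⟫) = τ * |a + ⟪b, w⟫| := by
    split_ifs at hw with h₁ h₂
    · have hw' : w = vtil - (-τ) • b := by rw [hw, neg_smul, sub_neg_eq_add]
      refine ⟨-τ, hw', by rw [abs_neg, abs_of_pos hτ], ?_⟩
      rw [hw', hinner, abs_of_neg (by linarith)]
      ring
    · refine ⟨τ, hw, (abs_of_pos hτ).le, ?_⟩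
      rw [hw, hinner, abs_of_pos (by linarith)]
    · refine ⟨(a + ⟪b, vtil⟫) / ‖b‖ ^ 2, hw, ?_, ?_⟩
      · rw [abs_div, abs_of_pos hb2, div_le_iff₀ hb2]
        exact abs_le.2 ⟨not_lt.1 h₁, not_lt.1 h₂⟩
      · rw [hw, hinner, div_mul_cancel₀ _ hb2.ne']
        simp
  have key := prox_abs_affine_add_sq_le hws hs hsub
  refine ⟨fun v => ?_, fun v hv => ?_⟩
  · linarith [key v, sq_nonneg ‖v - w‖]
  · have hsq : ‖v - w‖ ^ 2 = 0 := le_antisymm (by linarith [key v, hv w]) (sq_nonneg _)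
    exact sub_eq_zero.1 (norm_eq_zero.1 (pow_eq_zero_iff two_ne_zero |>.1 hsq))
end
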